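/- With the q-quadratic lattice and the operators D_x, S_x as in the context, let f(z) = az² + bz + c (deg f ≤ 2) and let n ≥ 2 be an integer. Define the polynomials A(z) = (aα/(α_nα_{n−1}))(z−𝔠₃)² + (f′(𝔠₃)/α_n)(z−𝔠₃) + f(𝔠₃) + 4a(1−α²)γ_n𝔠₁𝔠₂/α_{n−1}, B(z) = (γ_n/α_n)·( (a(α_n + αα_{n−1})/α_{n−1}²)(z−𝔠₃) + f′(𝔠₃) ), and the constant C = aγ_nγ_{n−1}/α_{n−1}². Then for every ℂ-linear functional u on complex polynomials and every polynomial g: u( f·D_x^n g ) = u( D_x^n(A·g) ) − u( S_x(D_x^{n−1}(B·g)) ) + u( S_x(S_x(D_x^{n−2}(C·g))) ). (This is the Leibniz formula 𝐃_x^n(fu) = A·𝐃_x^n u + B·𝐃_x^{n−1}𝐒_x u + C·𝐃_x^{n−2}𝐒_x² u expressed by duality.) -/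

import Mathlib

open Polynomial

noncomputable def qp (q : ℝ) (t : ℂ) : ℂ := Complex.exp (t * (Real.log q : ℂ))

noncomputable def alphaL (q : ℝ) : ℂ := (qp q (1/2) + qp q (-(1/2))) / 2

noncomputable def alphaN (q : ℝ) (n : ℕ) : ℂ :=
  (qp q ((n : ℂ) / 2) + qp q (-((n : ℂ) / 2))) / 2

noncomputable def gammaN (q : ℝ) (n : ℕ) : ℂ :=
  (qp q ((n : ℂ) / 2) - qp q (-((n : ℂ) / 2))) / (qp q (1/2) - qp q (-(1/2)))

noncomputable def latX (q : ℝ) (c1 c2 c3 s : ℂ) : ℂ := c1 * qp q (-s) + c2 * qp q s + c3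

section AskeyWilsonOperators

variable {q : ℝ}

theorem qp_add (q : ℝ) (s t : ℂ) : qp q (s + t) = qp q s * qp q t := by
  simp only [qp, add_mul, Complex.exp_add]

theorem qp_ne_zero (q : ℝ) (t : ℂ) : qp q t ≠ 0 := Complex.exp_ne_zero _

theorem qp_neg (q : ℝ) (t : ℂ) : qp q (-t) = (qp q t)⁻¹ := by
  simp only [qp, neg_mul, Complex.exp_neg]

theorem qp_natCast_div_two (q : ℝ) (n : ℕ) : qp q ((n : ℂ) / 2) = qp q (1 / 2) ^ n := by
  simp only [qp, ← Complex.exp_nat_mul]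
  congr 1
  ring

theorem log_ne_zero_of_pos (hq : 0 < q) (hq1 : q ≠ 1) : Real.log q ≠ 0 :=
  Real.log_ne_zero_of_pos_of_ne_one hq hq1

theorem exists_qp_eq (hq : 0 < q) (hq1 : q ≠ 1) {y : ℂ} (hy : y ≠ 0) : ∃ s, qp q s = y := by
  have h : (Real.log q : ℂ) ≠ 0 := by exact_mod_cast log_ne_zero_of_pos hq hq1
  refine ⟨Complex.log y / Real.log q, ?_⟩
  rw [qp, div_mul_cancel₀ _ h, Complex.exp_log hy]

theorem qp_half_eq_ofReal (q : ℝ) : qp q (1 / 2) = (Real.exp (Real.log q / 2) : ℂ) := by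
  rw [qp, Complex.ofReal_exp]
  congr 1
  push_cast
  ring

theorem qp_half_sub_inv_ne_zero (hq : 0 < q) (hq1 : q ≠ 1) :
    qp q (1 / 2) - (qp q (1 / 2))⁻¹ ≠ 0 := by
  rw [qp_half_eq_ofReal, ← Complex.ofReal_inv, ← Real.exp_neg, ← Complex.ofReal_sub,
    Complex.ofReal_ne_zero, sub_ne_zero]
  intro h
  have h' := Real.exp_injective h
  exact log_ne_zero_of_pos hq hq1 (by linarith)

theorem alphaN_eq (q : ℝ) (n : ℕ) :
    alphaN q n = (qp q (1 / 2) ^ n + (qp q (1 / 2) ^ n)⁻¹) / 2 := by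
  rw [alphaN, qp_neg, qp_natCast_div_two]

theorem gammaN_eq (q : ℝ) (n : ℕ) :
    gammaN q n = (qp q (1 / 2) ^ n - (qp q (1 / 2) ^ n)⁻¹) /
      (qp q (1 / 2) - (qp q (1 / 2))⁻¹) := by
  rw [gammaN, qp_neg, qp_neg, qp_natCast_div_two]

theorem alphaL_eq (q : ℝ) : alphaL q = (qp q (1 / 2) + (qp q (1 / 2))⁻¹) / 2 := by
  rw [alphaL, qp_neg]

theorem alphaN_ne_zero (q : ℝ) (n : ℕ) : alphaN q n ≠ 0 := by
  rw [alphaN_eq, qp_half_eq_ofReal]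
  have h : (Real.exp (Real.log q / 2) ^ n + (Real.exp (Real.log q / 2) ^ n)⁻¹) / 2 ≠ 0 := by
    positivity
  exact_mod_cast h

theorem alphaN_one (q : ℝ) : alphaN q 1 = alphaL q := by
  rw [alphaN_eq, alphaL_eq, pow_one]

theorem gammaN_one (hq : 0 < q) (hq1 : q ≠ 1) : gammaN q 1 = 1 := by
  rw [gammaN_eq, pow_one, div_self (qp_half_sub_inv_ne_zero hq hq1)]

theorem gammaN_mul_eq (hq : 0 < q) (hq1 : q ≠ 1) (n : ℕ) :
    gammaN q n * (qp q (1 / 2) - (qp q (1 / 2))⁻¹) =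
      qp q (1 / 2) ^ n - (qp q (1 / 2) ^ n)⁻¹ := by
  rw [gammaN_eq, div_mul_cancel₀ _ (qp_half_sub_inv_ne_zero hq hq1)]

theorem alphaL_sq_sub_one (q : ℝ) :
    alphaL q ^ 2 - 1 = (qp q (1 / 2) - (qp q (1 / 2))⁻¹) ^ 2 / 4 := by
  rw [alphaL_eq]
  linear_combination mul_inv_cancel₀ (qp_ne_zero q (1 / 2))

theorem alphaN_succ (hq : 0 < q) (hq1 : q ≠ 1) (n : ℕ) :
    alphaN q (n + 1) = alphaL q * alphaN q n + (alphaL q ^ 2 - 1) * gammaN q n := by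
  have h0 := qp_ne_zero q (1 / 2)
  have hg := gammaN_mul_eq hq hq1 n
  rw [alphaL_sq_sub_one, alphaN_eq, alphaN_eq, alphaL_eq, pow_succ, mul_inv]
  linear_combination (-(qp q (1 / 2) - (qp q (1 / 2))⁻¹) / 4) * hg

theorem gammaN_succ (hq : 0 < q) (hq1 : q ≠ 1) (n : ℕ) :
    gammaN q (n + 1) = alphaN q n + alphaL q * gammaN q n := by
  refine mul_right_cancel₀ (qp_half_sub_inv_ne_zero hq hq1) ?_
  have hg := gammaN_mul_eq hq hq1 n
  rw [gammaN_mul_eq hq hq1, alphaN_eq, alphaL_eq, pow_succ, mul_inv]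
  linear_combination (-(qp q (1 / 2) + (qp q (1 / 2))⁻¹) / 2) * hg

theorem alphaN_eq_succ (hq : 0 < q) (hq1 : q ≠ 1) (n : ℕ) :
    alphaN q n = alphaL q * alphaN q (n + 1) - (alphaL q ^ 2 - 1) * gammaN q (n + 1) := by
  rw [alphaN_succ hq hq1, gammaN_succ hq hq1]
  ring

theorem latX_add_half (q : ℝ) (c1 c2 c3 s : ℂ) : latX q c1 c2 c3 (s + 1 / 2) =
    c1 * ((qp q s)⁻¹ * (qp q (1 / 2))⁻¹) + c2 * (qp q s * qp q (1 / 2)) + c3 := by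
  rw [latX, qp_neg, qp_add, mul_inv]

theorem latX_sub_half (q : ℝ) (c1 c2 c3 s : ℂ) : latX q c1 c2 c3 (s - 1 / 2) =
    c1 * ((qp q s)⁻¹ * qp q (1 / 2)) + c2 * (qp q s * (qp q (1 / 2))⁻¹) + c3 := by
  rw [latX, qp_neg, sub_eq_add_neg, qp_add, mul_inv, qp_neg, inv_inv]

theorem latX_eq (q : ℝ) (c1 c2 c3 s : ℂ) :
    latX q c1 c2 c3 s = c1 * (qp q s)⁻¹ + c2 * qp q s + c3 := by
  rw [latX, qp_neg]

theorem latX_add_half_add_sub_half (q : ℝ) (c1 c2 c3 s : ℂ) :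
    latX q c1 c2 c3 (s + 1 / 2) + latX q c1 c2 c3 (s - 1 / 2) - 2 * c3 =
      2 * alphaL q * (latX q c1 c2 c3 s - c3) := by
  rw [latX_add_half, latX_sub_half, latX_eq, alphaL_eq]
  ring

theorem latX_add_half_sub_sub_half_sq (q : ℝ) (c1 c2 c3 s : ℂ) :
    (latX q c1 c2 c3 (s + 1 / 2) - latX q c1 c2 c3 (s - 1 / 2)) ^ 2 =
      4 * ((alphaL q ^ 2 - 1) * ((latX q c1 c2 c3 s - c3) ^ 2 - 4 * (c1 * c2))) := by
  have h := mul_inv_cancel₀ (qp_ne_zero q s)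
  rw [latX_add_half, latX_sub_half, latX_eq, alphaL_sq_sub_one]
  linear_combination (-4 * c1 * c2 * (qp q (1 / 2) - (qp q (1 / 2))⁻¹) ^ 2) * h

theorem latX_surjective (hq : 0 < q) (hq1 : q ≠ 1) {c1 c2 : ℂ} (hc : c1 * c2 ≠ 0) (c3 : ℂ) :
    Function.Surjective (latX q c1 c2 c3) := by
  intro w
  have h1 := left_ne_zero_of_mul hc
  have h2 := right_ne_zero_of_mul hc
  obtain ⟨d, hd⟩ := IsAlgClosed.exists_pow_nat_eq (n := 2) ((c3 - w) ^ 2 - 4 * c2 * c1) two_pos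
  have hy : c2 * ((-(c3 - w) + d) / (2 * c2)) ^ 2 +
      (c3 - w) * ((-(c3 - w) + d) / (2 * c2)) + c1 = 0 := by
    field_simp
    linear_combination hd
  generalize (-(c3 - w) + d) / (2 * c2) = y at hy
  have hy0 : y ≠ 0 := by
    rintro rfl
    exact h1 (by simpa using hy)
  obtain ⟨s, rfl⟩ := exists_qp_eq hq hq1 hy0
  refine ⟨s, ?_⟩
  rw [latX_eq]
  field_simp
  linear_combination hy

theorem eq_of_eval_latX (hq : 0 < q) (hq1 : q ≠ 1) {c1 c2 : ℂ} (hc : c1 * c2 ≠ 0) (c3 : ℂ)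
    {f g : ℂ[X]}
    (h : ∀ s, latX q c1 c2 c3 (s + 1 / 2) ≠ latX q c1 c2 c3 (s - 1 / 2) →
      f.eval (latX q c1 c2 c3 s) = g.eval (latX q c1 c2 c3 s)) : f = g := by
  have hk : alphaL q ^ 2 - 1 ≠ 0 := by
    rw [alphaL_sq_sub_one]
    exact div_ne_zero (pow_ne_zero _ (qp_half_sub_inv_ne_zero hq hq1)) (by norm_num)
  have hm : ((X - C c3) ^ 2 - C (4 * (c1 * c2)) : ℂ[X]) ≠ 0 := by
    intro h0
    have h1 := congrArg (eval c3) h0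
    simp only [eval_sub, eval_pow, eval_X, eval_C, sub_self, eval_zero] at h1
    exact hc (by linear_combination (-1 / 4) * h1)
  refine sub_eq_zero.mp ((mul_eq_zero.mp ?_).resolve_left hm)
  refine Polynomial.funext fun w => ?_
  obtain ⟨s, rfl⟩ := latX_surjective hq hq1 hc c3 w
  by_cases hs : latX q c1 c2 c3 (s + 1 / 2) = latX q c1 c2 c3 (s - 1 / 2)
  · have h2 := latX_add_half_sub_sub_half_sq q c1 c2 c3 s
    rw [hs, sub_self] at h2
    have h3 : (latX q c1 c2 c3 s - c3) ^ 2 - 4 * (c1 * c2) = 0 :=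
      (mul_eq_zero.mp (show (alphaL q ^ 2 - 1) * _ = 0 by
        linear_combination (-1 / 4) * h2)).resolve_left hk
    simp [h3]
  · simp [h s hs]

/-- The commutation rule `D S = α S D + (α² - 1) z D²` follows from the two product rules. -/
theorem D_S_of_product_rules {D S : ℂ[X] →ₗ[ℂ] ℂ[X]} {α c c3 : ℂ} (hD1 : D 1 = 0) (hS1 : S 1 = 1)
    (hDz : ∀ h, D ((X - C c3) * h) = S h + α • ((X - C c3) * D h))
    (hSz : ∀ h, S ((X - C c3) * h) =
      (α ^ 2 - 1) • (((X - C c3) * (X - C c3) - C c) * D h) + α • ((X - C c3) * S h)) (h : ℂ[X]) :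
    D (S h) = α • S (D h) + (α ^ 2 - 1) • ((X - C c3) * D (D h)) := by
  have hadd : ∀ f g : ℂ[X], D (S f) = α • S (D f) + (α ^ 2 - 1) • ((X - C c3) * D (D f)) →
      D (S g) = α • S (D g) + (α ^ 2 - 1) • ((X - C c3) * D (D g)) →
      D (S (f + g)) = α • S (D (f + g)) + (α ^ 2 - 1) • ((X - C c3) * D (D (f + g))) := by
    intro f g hf hg
    simp only [map_add, hf, hg, mul_add, smul_add]
    abel
  have hsmul : ∀ (a : ℂ) (f : ℂ[X]),
      D (S f) = α • S (D f) + (α ^ 2 - 1) • ((X - C c3) * D (D f)) →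
      D (S (a • f)) = α • S (D (a • f)) + (α ^ 2 - 1) • ((X - C c3) * D (D (a • f))) := by
    intro a f hf
    simp only [map_smul, hf, mul_smul_comm, smul_add]
    simp only [smul_smul, mul_comm]
  have hz : ∀ f : ℂ[X], D (S f) = α • S (D f) + (α ^ 2 - 1) • ((X - C c3) * D (D f)) →
      D (S ((X - C c3) * f)) = α • S (D ((X - C c3) * f)) +
        (α ^ 2 - 1) • ((X - C c3) * D (D ((X - C c3) * f))) := by
    intro f hf
    have hsub : ((X - C c3) * (X - C c3) - C c) * D f =
        (X - C c3) * ((X - C c3) * D f) - c • D f := by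
      rw [smul_eq_C_mul]; ring
    rw [hSz, hDz, hsub]
    simp only [map_add, map_sub, map_smul, hDz, hSz, hf]
    simp only [smul_eq_C_mul, map_sub, map_pow, map_one]
    ring
  have hone : D (S 1) = α • S (D 1) + (α ^ 2 - 1) • ((X - C c3) * D (D 1)) := by
    simp [hD1, hS1]
  have hX : ∀ f : ℂ[X], D (S f) = α • S (D f) + (α ^ 2 - 1) • ((X - C c3) * D (D f)) →
      D (S (X * f)) = α • S (D (X * f)) + (α ^ 2 - 1) • ((X - C c3) * D (D (X * f))) := by
    intro f hf
    have hx : X * f = (X - C c3) * f + c3 • f := by rw [smul_eq_C_mul]; ring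
    rw [hx]
    exact hadd _ _ (hz f hf) (hsmul c3 f hf)
  have hpow : ∀ n : ℕ, D (S (X ^ n)) =
      α • S (D (X ^ n)) + (α ^ 2 - 1) • ((X - C c3) * D (D (X ^ n))) := by
    intro n
    induction n with
    | zero => simpa using hone
    | succ n ih => rw [pow_succ']; exact hX _ ih
  refine Polynomial.induction_on' h (fun f g hf hg => hadd f g hf hg) (fun n a => ?_)
  rw [← C_mul_X_pow_eq_monomial, ← smul_eq_C_mul]
  exact hsmul a _ (hpow n)

theorem iterate_D_mul_X_sub_C {D S : ℂ[X] →ₗ[ℂ] ℂ[X]} {c3 : ℂ} (hq : 0 < q) (hq1 : q ≠ 1)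
    (hDz : ∀ h, D ((X - C c3) * h) = S h + alphaL q • ((X - C c3) * D h))
    (hDS : ∀ h, D (S h) =
      alphaL q • S (D h) + (alphaL q ^ 2 - 1) • ((X - C c3) * D (D h))) (g : ℂ[X]) (n : ℕ) :
    D^[n + 1] ((X - C c3) * g) =
      alphaN q (n + 1) • ((X - C c3) * D^[n + 1] g) + gammaN q (n + 1) • S (D^[n] g) := by
  induction n with
  | zero =>
    simp only [zero_add, Function.iterate_one, Function.iterate_zero, id, alphaN_one,
      gammaN_one hq hq1, hDz, one_smul]
    abel
  | succ n ih =>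
    rw [Function.iterate_succ_apply', ih, alphaN_succ hq hq1 (n + 1), gammaN_succ hq hq1 (n + 1)]
    simp only [map_add, map_smul, hDz, hDS, ← Function.iterate_succ_apply' (⇑D)]
    simp only [smul_eq_C_mul, map_sub, map_pow, map_one, map_add, map_mul]
    ring

theorem mul_iterate_D_eq {D S : ℂ[X] →ₗ[ℂ] ℂ[X]} {c1 c2 c3 : ℂ} (hq : 0 < q) (hq1 : q ≠ 1)
    (hDz : ∀ h, D ((X - C c3) * h) = S h + alphaL q • ((X - C c3) * D h))
    (hSz : ∀ h, S ((X - C c3) * h) =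
      (alphaL q ^ 2 - 1) • (((X - C c3) * (X - C c3) - C (4 * (c1 * c2))) * D h) +
        alphaL q • ((X - C c3) * S h))
    (hDS : ∀ h, D (S h) =
      alphaL q • S (D h) + (alphaL q ^ 2 - 1) • ((X - C c3) * D (D h))) (pa pb pc : ℂ) (m : ℕ)
    (g : ℂ[X]) :
    (C pa * X ^ 2 + C pb * X + C pc) * D^[m + 2] g =
      D^[m + 2] ((C (pa * alphaL q / (alphaN q (m + 2) * alphaN q (m + 1))) * (X - C c3) ^ 2 +
          C ((2 * pa * c3 + pb) / alphaN q (m + 2)) * (X - C c3) +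
          C (pa * c3 ^ 2 + pb * c3 + pc +
            4 * pa * (1 - alphaL q ^ 2) * gammaN q (m + 2) * c1 * c2 / alphaN q (m + 1))) * g) -
        S (D^[m + 1] ((C (gammaN q (m + 2) / alphaN q (m + 2)) *
          (C (pa * (alphaN q (m + 2) + alphaL q * alphaN q (m + 1)) / alphaN q (m + 1) ^ 2) *
            (X - C c3) + C (2 * pa * c3 + pb))) * g)) +
        S (S (D^[m] (C (pa * gammaN q (m + 2) * gammaN q (m + 1) / alphaN q (m + 1) ^ 2) * g))) := by
  have hA := alphaN_ne_zero q (m + 2)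
  have hB := alphaN_ne_zero q (m + 1)
  have hrec := alphaN_eq_succ hq hq1 (m + 1)
  have h2 := iterate_D_mul_X_sub_C hq hq1 hDz hDS ((X - C c3) * g) (m + 1)
  have h3 := iterate_D_mul_X_sub_C hq hq1 hDz hDS g (m + 1)
  have h4 := congrArg S (iterate_D_mul_X_sub_C hq hq1 hDz hDS g m)
  rw [map_add, map_smul, map_smul, hSz, ← Function.iterate_succ_apply' (⇑D)] at h4
  have hquad : ∀ a b c : ℂ, (C a * (X - C c3) ^ 2 + C b * (X - C c3) + C c) * g =
      a • ((X - C c3) * ((X - C c3) * g)) + b • ((X - C c3) * g) + c • g := by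
    intro a b c
    simp only [smul_eq_C_mul]
    ring
  have hlin : ∀ a b c : ℂ, (C a * (C b * (X - C c3) + C c)) * g =
      (a * b) • ((X - C c3) * g) + (a * c) • g := by
    intro a b c
    simp only [smul_eq_C_mul, map_mul]
    ring
  rw [hquad, hlin, ← smul_eq_C_mul (p := g)]
  simp only [← Module.End.pow_apply, map_add, map_smul] at h2 h3 h4 ⊢
  rw [h2, h4, h3]
  refine Polynomial.funext fun w => ?_
  simp only [eval_add, eval_sub, eval_mul, eval_smul, eval_pow, eval_X, eval_C, smul_eq_mul]
  generalize eval w ((D ^ (m + 2)) g) = G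
  field_simp
  linear_combination alphaN q (m + 2) * alphaN q (m + 1) * pa * (w - c3) ^ 2 * G * hrec

end AskeyWilsonOperators

theorem stmt_8 (q : ℝ) (hq : 0 < q) (hq1 : q ≠ 1) (c1 c2 c3 : ℂ) (hc : c1 * c2 ≠ 0)
    (Dx Sx : Polynomial ℂ → Polynomial ℂ)
    (hDx : ∀ (f : Polynomial ℂ) (s : ℂ),
      latX q c1 c2 c3 (s + 1/2) ≠ latX q c1 c2 c3 (s - 1/2) →
      (Dx f).eval (latX q c1 c2 c3 s) =
        (f.eval (latX q c1 c2 c3 (s + 1/2)) - f.eval (latX q c1 c2 c3 (s - 1/2))) /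
          (latX q c1 c2 c3 (s + 1/2) - latX q c1 c2 c3 (s - 1/2)))
    (hSx : ∀ (f : Polynomial ℂ) (s : ℂ),
      (Sx f).eval (latX q c1 c2 c3 s) =
        (f.eval (latX q c1 c2 c3 (s + 1/2)) + f.eval (latX q c1 c2 c3 (s - 1/2))) / 2)
    (pa pb pc : ℂ) (n : ℕ) (hn : 2 ≤ n)
    (u : Polynomial ℂ →ₗ[ℂ] ℂ) :
    ∀ g : Polynomial ℂ,
      u ((C pa * X ^ 2 + C pb * X + C pc) * Dx^[n] g) =
        u (Dx^[n] ((C (pa * alphaL q / (alphaN q n * alphaN q (n - 1))) * (X - C c3) ^ 2 +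
          C ((2 * pa * c3 + pb) / alphaN q n) * (X - C c3) +
          C (pa * c3 ^ 2 + pb * c3 + pc +
            4 * pa * (1 - alphaL q ^ 2) * gammaN q n * c1 * c2 / alphaN q (n - 1))) * g)) -
        u (Sx (Dx^[n - 1] ((C (gammaN q n / alphaN q n) *
          (C (pa * (alphaN q n + alphaL q * alphaN q (n - 1)) / alphaN q (n - 1) ^ 2) *
            (X - C c3) + C (2 * pa * c3 + pb))) * g))) +
        u (Sx (Sx (Dx^[n - 2] (C (pa * gammaN q n * gammaN q (n - 1) / alphaN q (n - 1) ^ 2) * g)))) := by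
  have ext := fun {f g : ℂ[X]} => eq_of_eval_latX hq hq1 hc c3 (f := f) (g := g)
  let D : ℂ[X] →ₗ[ℂ] ℂ[X] :=
    { toFun := Dx
      map_add' := fun f g => ext fun s hs => by
        simp only [eval_add, hDx _ s hs]
        ring
      map_smul' := fun a f => ext fun s hs => by
        simp only [eval_smul, hDx _ s hs, RingHom.id_apply, smul_eq_mul]
        ring }
  let S : ℂ[X] →ₗ[ℂ] ℂ[X] :=
    { toFun := Sx
      map_add' := fun f g => ext fun s _ => by
        simp only [eval_add, hSx]
        ring
      map_smul' := fun a f => ext fun s _ => by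
        simp only [eval_smul, hSx, RingHom.id_apply, smul_eq_mul]
        ring }
  have hD1 : D 1 = 0 := ext fun s hs => by
    change (Dx 1).eval _ = _
    simp [hDx _ s hs]
  have hS1 : S 1 = 1 := ext fun s _ => by
    change (Sx 1).eval _ = _
    simp [hSx]
  have hDz : ∀ h, D ((X - C c3) * h) = S h + alphaL q • ((X - C c3) * D h) := by
    refine fun h => ext fun s hs => ?_
    change (Dx _).eval _ = (Sx h + alphaL q • ((X - C c3) * Dx h)).eval _
    have h1 := latX_add_half_add_sub_half q c1 c2 c3 s
    have h0 := sub_ne_zero.mpr hs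
    simp only [eval_add, eval_smul, eval_mul, eval_sub, eval_X, eval_C, hDx _ s hs, hSx,
      smul_eq_mul]
    generalize latX q c1 c2 c3 (s + 1 / 2) = xp at *
    generalize latX q c1 c2 c3 (s - 1 / 2) = xm at *
    field_simp
    linear_combination (eval xp h - eval xm h) * h1
  have hSz : ∀ h, S ((X - C c3) * h) =
      (alphaL q ^ 2 - 1) • (((X - C c3) * (X - C c3) - C (4 * (c1 * c2))) * D h) +
        alphaL q • ((X - C c3) * S h) := by
    refine fun h => ext fun s hs => ?_
    change (Sx _).eval _ = ((alphaL q ^ 2 - 1) • ((_ - C (4 * (c1 * c2))) * Dx h) +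
      alphaL q • ((X - C c3) * Sx h)).eval _
    have h1 := latX_add_half_add_sub_half q c1 c2 c3 s
    have h2 := latX_add_half_sub_sub_half_sq q c1 c2 c3 s
    have h0 := sub_ne_zero.mpr hs
    simp only [eval_add, eval_smul, eval_mul, eval_sub, eval_X, eval_C, hDx _ s hs, hSx,
      smul_eq_mul]
    generalize latX q c1 c2 c3 (s + 1 / 2) = xp at *
    generalize latX q c1 c2 c3 (s - 1 / 2) = xm at *
    field_simp
    linear_combination (xp - xm) * (eval xp h + eval xm h) / 2 * h1 +
      (eval xp h - eval xm h) / 2 * h2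
  intro g
  obtain ⟨m, rfl⟩ := Nat.exists_eq_add_of_le' hn
  have key := mul_iterate_D_eq hq hq1 hDz hSz (D_S_of_product_rules hD1 hS1 hDz hSz) pa pb pc m g
  have := congrArg u key
  rw [map_add, map_sub] at this
  exact this
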